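/- arXiv:1807.00109 — 2 statements merged into one kernel-verified Lean document; each statement's English description precedes it below -/
import Mathlib

section
/- Let Γ be a group. For any triplet (𝔾, s, t) ∈ 𝒟, the set l(𝔾; s, t) consists of exactly one element if and only if 𝔾 is balanced. -/
/-- A Γ-labeled graph: a finite loopless directed multigraph with arcs labeled by
elements of a group Γ.  An arc is represented as a triple `(tail, head, label)`. -/
structure LGraph (V : Type) (Γ : Type) [Group Γ] where
  verts : Set V
  arcs : Set (V × V × Γ)
  verts_finite : verts.Finite
  arcs_finite : arcs.Finite
  tail_mem : ∀ a ∈ arcs, a.1 ∈ verts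
  head_mem : ∀ a ∈ arcs, a.2.1 ∈ verts
  loopless : ∀ a ∈ arcs, a.1 ≠ a.2.1

namespace LGraph

variable {V : Type} {Γ : Type} [Group Γ]

/-- `connects a u v` : the arc `a` joins `u` and `v` (traversed from `u` to `v`,
in either direction of the arc). -/
def connects (a : V × V × Γ) (u v : V) : Prop :=
  (a.1 = u ∧ a.2.1 = v) ∨ (a.1 = v ∧ a.2.1 = u)

/-- Walks in the underlying undirected graph of a Γ-labeled graph. -/
inductive Walk (G : LGraph V Γ) : V → V → Type
  | nil (v : V) : Walk G v v
  | cons (u v : V) {w : V} (a : V × V × Γ) (ha : a ∈ G.arcs)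
      (hstep : connects a u v) (W : Walk G v w) : Walk G u w

variable [DecidableEq V]

/-- `ψ_𝔾(e, v)` : the label contributed by arc `a` when traversed arriving at `v` :
the arc's label if the arc enters `v`, its inverse if it leaves `v`. -/
def stepLabel (v : V) (a : V × V × Γ) : Γ :=
  if a.2.1 = v then a.2.2 else a.2.2⁻¹

namespace Walk

variable {G : LGraph V Γ}

/-- The label `ψ_𝔾(W)` of a walk: the product of the step labels, later steps
multiplied on the left. -/
def label : {u w : V} → G.Walk u w → Γ
  | _, _, .nil _ => 1
  | _, _, .cons _ v a _ _ W => label W * stepLabel v a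

/-- The list of vertices of a walk, in order. -/
def support : {u w : V} → G.Walk u w → List V
  | _, _, .nil v => [v]
  | _, _, .cons u _ _ _ _ W => u :: support W

/-- The list of traversed arcs of a walk, in order. -/
def arcsList : {u w : V} → G.Walk u w → List (V × V × Γ)
  | _, _, .nil _ => []
  | _, _, .cons _ _ a _ _ W => a :: arcsList W

/-- The length (number of edges) of a walk. -/
def length : {u w : V} → G.Walk u w → ℕ
  | _, _, .nil _ => 0
  | _, _, .cons _ _ _ _ _ W => length W + 1

/-- A walk is a path if all its vertices are distinct. -/
def IsPath {u w : V} (W : G.Walk u w) : Prop := W.support.Nodup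

/-- A closed walk is a cycle if it is nonempty, its edges are distinct and its
vertices (except for the repeated end vertex) are distinct. -/
def IsCycle {v : V} (W : G.Walk v v) : Prop :=
  1 ≤ W.length ∧ W.arcsList.Nodup ∧ W.support.dropLast.Nodup

end Walk

/-- `l(𝔾; s, t)` : the set of all labels of s–t paths in `G`. -/
def labelSet (G : LGraph V Γ) (s t : V) : Set Γ :=
  {γ | ∃ P : G.Walk s t, P.IsPath ∧ P.label = γ}

/-- A Γ-labeled graph is balanced if every cycle has label `1`. -/
def Balanced (G : LGraph V Γ) : Prop :=
  ∀ (v : V) (C : G.Walk v v), C.IsCycle → C.label = 1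

/-- Connectivity of (the underlying graph of) a Γ-labeled graph. -/
def Connected (G : LGraph V Γ) : Prop :=
  ∀ u ∈ G.verts, ∀ w ∈ G.verts, Nonempty (G.Walk u w)

/-- `G` has no pair of equivalent arcs: no two distinct arcs that are parallel with
the same label, or antiparallel with mutually inverse labels. -/
def NoEquivArcs (G : LGraph V Γ) : Prop :=
  ∀ a ∈ G.arcs, ∀ b ∈ G.arcs, a ≠ b →
    ¬ ((a.1 = b.1 ∧ a.2.1 = b.2.1 ∧ a.2.2 = b.2.2) ∨
       (a.1 = b.2.1 ∧ a.2.1 = b.1 ∧ a.2.2 = b.2.2⁻¹))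

/-- `(𝔾, s, t) ∈ 𝒟` : `s, t` are distinct vertices, every vertex lies on some
s–t path, and there are no equivalent arcs. -/
def MemD (G : LGraph V Γ) (s t : V) : Prop :=
  s ≠ t ∧ s ∈ G.verts ∧ t ∈ G.verts ∧
  (∀ v ∈ G.verts, ∃ P : G.Walk s t, P.IsPath ∧ v ∈ P.support) ∧
  G.NoEquivArcs

/-- `(s,t)`-equivalence: `H` is obtained from `G` by shifting by `φ v` at each
vertex `v`, where `φ` vanishes at `s` and `t`. -/
def STEquiv (s t : V) (G H : LGraph V Γ) : Prop :=
  ∃ φ : V → Γ, φ s = 1 ∧ φ t = 1 ∧ H.verts = G.verts ∧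
    H.arcs = (fun a : V × V × Γ => (a.1, a.2.1, φ a.2.1 * a.2.2 * (φ a.1)⁻¹)) '' G.arcs

/-- The subgraph induced by a vertex set `X`. -/
def induce (G : LGraph V Γ) (X : Set V) : LGraph V Γ where
  verts := G.verts ∩ X
  arcs := {a ∈ G.arcs | a.1 ∈ X ∧ a.2.1 ∈ X}
  verts_finite := G.verts_finite.subset Set.inter_subset_left
  arcs_finite := G.arcs_finite.subset fun _ ha => ha.1
  tail_mem := fun a ha => ⟨G.tail_mem a ha.1, ha.2.1⟩
  head_mem := fun a ha => ⟨G.head_mem a ha.1, ha.2.2⟩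
  loopless := fun a ha => G.loopless a ha.1

/-- `𝔾 − Y` : deletion of the vertex set `Y`. -/
def delete (G : LGraph V Γ) (Y : Set V) : LGraph V Γ := G.induce Yᶜ

/-- `N_𝔾(X)` : the set of vertices outside `X` adjacent to `X`. -/
def nbhd (G : LGraph V Γ) (X : Set V) : Set V :=
  {y | y ∉ X ∧ ∃ x ∈ X, ∃ a ∈ G.arcs, connects a x y}

/-- `𝔾⟦X⟧` : the subgraph induced by `X ∪ N(X)` with the edges inside `N(X)` removed. -/
def around (G : LGraph V Γ) (X : Set V) : LGraph V Γ where
  verts := G.verts ∩ (X ∪ G.nbhd X)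
  arcs := {a ∈ G.arcs | (a.1 ∈ X ∪ G.nbhd X) ∧ (a.2.1 ∈ X ∪ G.nbhd X) ∧
            ¬ (a.1 ∈ G.nbhd X ∧ a.2.1 ∈ G.nbhd X)}
  verts_finite := G.verts_finite.subset Set.inter_subset_left
  arcs_finite := G.arcs_finite.subset fun _ ha => ha.1
  tail_mem := fun a ha => ⟨G.tail_mem a ha.1, ha.2.1⟩
  head_mem := fun a ha => ⟨G.head_mem a ha.1, ha.2.2.1⟩
  loopless := fun a ha => G.loopless a ha.1

/-- The arcs of `G` surviving the removal of the vertex set `X`. -/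
def keptArcs (G : LGraph V Γ) (X : Set V) : Set (V × V × Γ) :=
  {a ∈ G.arcs | a.1 ∉ X ∧ a.2.1 ∉ X}

/-- `A` contains an arc equivalent to an arc from `x` to `y` with label `γ`. -/
def hasEquivArc (A : Set (V × V × Γ)) (x y : V) (γ : Γ) : Prop :=
  (x, y, γ) ∈ A ∨ (y, x, γ⁻¹) ∈ A

/-- The new arcs added by a contraction of `X`, between `x` and `y`: an arc from `x`
to `y` with label `γ` for each `γ ∈ l(𝔾⟦X⟧; x, y)`, unless an equivalent arc
already exists among the kept arcs. -/
def newContractionArcs (G : LGraph V Γ) (X : Set V) (x y : V) : Set (V × V × Γ) :=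
  {p | ∃ γ ∈ labelSet (G.around X) x y, p = (x, y, γ) ∧ ¬ hasEquivArc (G.keptArcs X) x y γ}

/-- The arc set of the 2-contraction `𝔾 /₂ X`, where `N_𝔾(X) = {x, y}`. -/
def contract2Arcs (G : LGraph V Γ) (X : Set V) (x y : V) : Set (V × V × Γ) :=
  G.keptArcs X ∪ G.newContractionArcs X x y

/-- The arc set of the 3-contraction `𝔾 /₃ X`, where `N_𝔾(X) = {x, y, z}`. -/
def contract3Arcs (G : LGraph V Γ) (X : Set V) (x y z : V) : Set (V × V × Γ) :=
  G.keptArcs X ∪ G.newContractionArcs X x y ∪ G.newContractionArcs X y z ∪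
    G.newContractionArcs X x z

/-- `X` is 2-contractible in `𝔾` (w.r.t. the terminals `s, t`). -/
def TwoContractible (G : LGraph V Γ) (s t : V) (X : Set V) : Prop :=
  X ⊆ G.verts \ {s, t} ∧
  (∃ x y : V, x ≠ y ∧ G.nbhd X = {x, y}) ∧
  (G.around X).Connected ∧ G.around X ≠ G

/-- `X` is 3-contractible in `𝔾` (w.r.t. the terminals `s, t`). -/
def ThreeContractible (G : LGraph V Γ) (s t : V) (X : Set V) : Prop :=
  X ⊆ G.verts \ {s, t} ∧
  (∃ x y z : V, x ≠ y ∧ x ≠ z ∧ y ≠ z ∧ G.nbhd X = {x, y, z}) ∧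
  (G.induce X).Connected ∧ (G.around X).Balanced

/-- The graph obtained by adding a single `s`–`t` edge (with an arbitrary label). -/
def addEdge (G : LGraph V Γ) (s t : V) (hs : s ∈ G.verts) (ht : t ∈ G.verts)
    (hst : s ≠ t) : LGraph V Γ where
  verts := G.verts
  arcs := insert (s, t, (1 : Γ)) G.arcs
  verts_finite := G.verts_finite
  arcs_finite := G.arcs_finite.insert _
  tail_mem := by
    intro a ha
    rcases Set.mem_insert_iff.mp ha with rfl | h
    · exact hs
    · exact G.tail_mem a h
  head_mem := by
    intro a ha
    rcases Set.mem_insert_iff.mp ha with rfl | h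
    · exact ht
    · exact G.head_mem a h
  loopless := by
    intro a ha
    rcases Set.mem_insert_iff.mp ha with rfl | h
    · exact hst
    · exact G.loopless a h

/-- 2-connectivity: more than 2 vertices, and removing any single vertex leaves
the graph connected. -/
def TwoConnected (G : LGraph V Γ) : Prop :=
  2 < G.verts.ncard ∧ ∀ v : V, (G.delete {v}).Connected

/-- The effect of shifting by `α` at `v` on a single arc. -/
def shiftArc (v : V) (α : Γ) (a : V × V × Γ) : V × V × Γ :=
  (a.1, a.2.1, if a.2.1 = v then α * a.2.2 else if a.1 = v then a.2.2 * α⁻¹ else a.2.2)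

/-- The graph obtained from `G` by shifting by `α` at `v`. -/
def shift (G : LGraph V Γ) (v : V) (α : Γ) : LGraph V Γ where
  verts := G.verts
  arcs := shiftArc v α '' G.arcs
  verts_finite := G.verts_finite
  arcs_finite := G.arcs_finite.image _
  tail_mem := by rintro a ⟨b, hb, rfl⟩; exact G.tail_mem b hb
  head_mem := by rintro a ⟨b, hb, rfl⟩; exact G.head_mem b hb
  loopless := by rintro a ⟨b, hb, rfl⟩; exact G.loopless b hb

/-- The walk in `G.shift v α` corresponding to a walk in `G`. -/
def Walk.shiftMap {G : LGraph V Γ} (v : V) (α : Γ) :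
    {u w : V} → G.Walk u w → (G.shift v α).Walk u w
  | _, _, .nil x => .nil x
  | _, _, .cons u x a ha hstep W =>
      .cons u x (shiftArc v α a) (Set.mem_image_of_mem _ ha) hstep (Walk.shiftMap v α W)

end LGraph

namespace LGraph

section Lists

variable {V : Type*}

theorem exists_first_of_mem {p : V → Prop} {l : List V} {x : V} (hx : x ∈ l) (hp : p x) :
    ∃ l₁ y l₂, l = l₁ ++ y :: l₂ ∧ p y ∧ ∀ z ∈ l₁, ¬ p z := by
  induction l with
  | nil => simp at hx
  | cons b l ih =>
    by_cases hb : p b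
    · exact ⟨[], b, l, rfl, hb, by simp⟩
    · have : x ∈ l := by
        rcases List.mem_cons.mp hx with rfl | h
        exacts [absurd hp hb, h]
      obtain ⟨l₁, y, l₂, rfl, hy, h⟩ := ih this
      exact ⟨b :: l₁, y, l₂, rfl, hy, by simpa [hb] using h⟩

theorem exists_last_of_mem {p : V → Prop} {l : List V} {x : V} (hx : x ∈ l) (hp : p x) :
    ∃ l₁ y l₂, l = l₁ ++ y :: l₂ ∧ p y ∧ ∀ z ∈ l₂, ¬ p z := by
  obtain ⟨l₁, y, l₂, h, hy, hn⟩ := exists_first_of_mem (List.mem_reverse.mpr hx) hp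
  exact ⟨l₂.reverse, y, l₁.reverse, by simpa using congrArg List.reverse h, hy, by simpa using hn⟩

theorem exists_two_or_unique {p : V → Prop} {l : List V} {x : V} (hx : x ∈ l) (hp : p x) :
    (∃ l₁ y l₂ z l₃, l = l₁ ++ y :: (l₂ ++ z :: l₃) ∧ p y ∧ p z ∧
      (∀ u ∈ l₁, ¬ p u) ∧ ∀ u ∈ l₃, ¬ p u) ∨
    ∃ l₁ l₂, l = l₁ ++ x :: l₂ ∧ (∀ u ∈ l₁, ¬ p u) ∧ ∀ u ∈ l₂, ¬ p u := by
  obtain ⟨l₁, y, r, rfl, hy, hn⟩ := exists_first_of_mem hx hp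
  by_cases h : ∃ z ∈ r, p z
  · obtain ⟨z, hz, hpz⟩ := h
    obtain ⟨l₂, z, l₃, rfl, hz, hn'⟩ := exists_last_of_mem hz hpz
    exact .inl ⟨l₁, y, l₂, z, l₃, rfl, hy, hz, hn, hn'⟩
  · push Not at h
    refine .inr ⟨l₁, r, ?_, hn, h⟩
    grind

theorem exists_repeat_of_not_nodup {l : List V} (h : ¬ l.Nodup) :
    ∃ l₁ x l₂ l₃, l = l₁ ++ x :: (l₂ ++ x :: l₃) := by
  induction l with
  | nil => simp at h
  | cons b l ih =>
    by_cases hb : b ∈ l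
    · obtain ⟨l₂, l₃, rfl⟩ := List.append_of_mem hb
      exact ⟨[], b, l₂, l₃, rfl⟩
    · obtain ⟨l₁, x, l₂, l₃, rfl⟩ := ih fun hl => h (List.nodup_cons.mpr ⟨hb, hl⟩)
      exact ⟨b :: l₁, x, l₂, l₃, rfl⟩

end Lists

theorem connects.symm {V Γ : Type} {a : V × V × Γ} {u v : V} (h : connects a u v) : connects a v u :=
  Or.symm h

variable {V Γ : Type} [Group Γ] [DecidableEq V] {G : LGraph V Γ}

theorem stepLabel_reverse {a : V × V × Γ} {u v : V} (ha : a ∈ G.arcs) (h : connects a u v) :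
    stepLabel u a = (stepLabel v a)⁻¹ := by
  have := G.loopless a ha
  unfold stepLabel
  rcases h with ⟨rfl, rfl⟩ | ⟨rfl, rfl⟩ <;> simp [this.symm]

/-- `G.Traces u S w g`: some walk from `u` to `w` has vertex sequence `S` and label `g`. -/
def Traces (G : LGraph V Γ) (u : V) (S : List V) (w : V) (g : Γ) : Prop :=
  ∃ W : G.Walk u w, W.support = S ∧ W.label = g

namespace Traces

variable {u v w x : V} {S l₁ l₂ : List V} {g g₁ g₂ : Γ}

theorem exists_eq_cons (h : G.Traces u S w g) : ∃ l, S = u :: l := by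
  obtain ⟨W, rfl, -⟩ := h
  cases W <;> simp [Walk.support]

theorem cons {a : V × V × Γ} (ha : a ∈ G.arcs) (hc : connects a u v) (h : G.Traces v S w g) :
    G.Traces u (u :: S) w (g * stepLabel v a) := by
  obtain ⟨W, rfl, rfl⟩ := h
  exact ⟨.cons u v a ha hc W, rfl, rfl⟩

theorem append (h₁ : G.Traces u (l₁ ++ [x]) x g₁) (h₂ : G.Traces x (x :: l₂) w g₂) :
    G.Traces u (l₁ ++ x :: l₂) w (g₂ * g₁) := by
  obtain ⟨W, hS, rfl⟩ := h₁
  induction W generalizing l₁ with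
  | nil v =>
    cases l₁ with
    | nil => simpa [Walk.label] using h₂
    | cons b l => simp [Walk.support] at hS
  | cons u v a ha hc W ih =>
    cases l₁ with
    | nil => cases W <;> simp [Walk.support] at hS
    | cons b l =>
      simp only [Walk.support, List.cons_append, List.cons.injEq] at hS
      obtain ⟨rfl, hS⟩ := hS
      simpa [Walk.label, mul_assoc] using (ih h₂ hS).cons ha hc

theorem split (h : G.Traces u (l₁ ++ x :: l₂) w g) :
    ∃ g₁ g₂, G.Traces u (l₁ ++ [x]) x g₁ ∧ G.Traces x (x :: l₂) w g₂ ∧ g = g₂ * g₁ := by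
  obtain ⟨W, hS, rfl⟩ := h
  induction W generalizing l₁ with
  | nil v =>
    cases l₁ with
    | nil =>
      simp only [Walk.support, List.nil_append, List.cons.injEq] at hS
      obtain ⟨rfl, rfl⟩ := hS
      exact ⟨1, 1, ⟨.nil v, rfl, rfl⟩, ⟨.nil v, rfl, rfl⟩, by simp [Walk.label]⟩
    | cons b l => simp [Walk.support] at hS
  | cons u v a ha hc W ih =>
    cases l₁ with
    | nil =>
      simp only [Walk.support, List.nil_append, List.cons.injEq] at hS
      obtain ⟨rfl, rfl⟩ := hS
      exact ⟨1, _, ⟨.nil u, rfl, rfl⟩, ⟨.cons u v a ha hc W, rfl, rfl⟩, by simp⟩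
    | cons b l =>
      simp only [Walk.support, List.cons_append, List.cons.injEq] at hS
      obtain ⟨rfl, hS⟩ := hS
      obtain ⟨g₁, g₂, h₁, h₂, hg⟩ := ih hS
      exact ⟨_, g₂, h₁.cons ha hc, h₂, by simp [Walk.label, hg, mul_assoc]⟩

theorem reverse (h : G.Traces u S w g) : G.Traces w S.reverse u g⁻¹ := by
  obtain ⟨W, rfl, rfl⟩ := h
  induction W with
  | nil v => exact ⟨.nil v, by simp [Walk.support], by simp [Walk.label]⟩
  | cons u v a ha hc W ih =>
    obtain ⟨l, hl⟩ := exists_eq_cons ⟨W, rfl, rfl⟩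
    have hu : G.Traces v [v, u] u (stepLabel u a) := by
      simpa using cons (S := [u]) (g := 1) ha hc.symm ⟨.nil u, rfl, rfl⟩
    rw [hl, List.reverse_cons] at ih
    simpa [Walk.support, Walk.label, hl, stepLabel_reverse ha hc] using ih.append hu

theorem exists_eq_concat (h : G.Traces u S w g) : ∃ l, S = l ++ [w] := by
  obtain ⟨l, hl⟩ := h.reverse.exists_eq_cons
  exact ⟨l.reverse, by simpa using congrArg List.reverse hl⟩

theorem mem_verts (h : G.Traces u S w g) (hS : 2 ≤ S.length) (hx : x ∈ S) : x ∈ G.verts := by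
  obtain ⟨W, rfl, rfl⟩ := h
  induction W with
  | nil v => simp [Walk.support] at hS
  | cons u v a ha hc W ih =>
    have huv : u ∈ G.verts ∧ v ∈ G.verts := by
      have h₁ := G.tail_mem a ha
      have h₂ := G.head_mem a ha
      rcases hc with ⟨rfl, rfl⟩ | ⟨rfl, rfl⟩ <;> exact ⟨‹_›, ‹_›⟩
    cases W with
    | nil v =>
      simp only [Walk.support, List.mem_cons, List.not_mem_nil, or_false] at hx
      rcases hx with rfl | rfl
      exacts [huv.1, huv.2]
    | cons v v' a' ha' hc' W =>
      rcases List.mem_cons.mp hx with rfl | hx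
      · exact huv.1
      · refine ih ?_ hx
        cases W <;> simp [Walk.support]

/-- Rotating a closed walk to another base vertex conjugates its label. -/
theorem rotate {c : List V} (h : G.Traces v (c ++ [v]) v g) (hx : x ∈ c) :
    ∃ c' g', G.Traces x (x :: c' ++ [x]) x g' ∧ (x :: c').Perm c ∧ (g' = 1 → g = 1) := by
  obtain ⟨c₁, c₂, rfl⟩ := List.append_of_mem hx
  rw [List.append_assoc, List.cons_append] at h
  obtain ⟨g₁, g₂, h₁, h₂, rfl⟩ := h.split
  cases c₁ with
  | nil =>
    obtain ⟨l, hl⟩ := h.exists_eq_cons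
    simp only [List.nil_append, List.cons.injEq] at hl
    obtain ⟨rfl, -⟩ := hl
    exact ⟨c₂, _, h, .refl _, id⟩
  | cons b c₁ =>
    obtain ⟨l, hl⟩ := h.exists_eq_cons
    simp only [List.cons_append, List.cons.injEq] at hl
    obtain ⟨rfl, -⟩ := hl
    refine ⟨c₂ ++ b :: c₁, g₁ * g₂, ?_, ?_, mul_eq_one_comm.mp⟩
    · simpa using append (l₁ := x :: c₂) h₂ h₁
    · exact List.perm_append_comm (l₁ := x :: c₂)

/-- Two distinct vertices of a closed walk split it into two walks between them. -/
theorem exists_arcs {c : List V} {y : V} (h : G.Traces v (c ++ [v]) v g) (hx : x ∈ c) (hy : y ∈ c)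
    (hxy : x ≠ y) :
    ∃ m n g₁ g₂, G.Traces x (x :: m ++ [y]) y g₁ ∧ G.Traces y (y :: n ++ [x]) x g₂ ∧
      (x :: m ++ y :: n).Perm c ∧ (g₂ * g₁ = 1 → g = 1) := by
  obtain ⟨c', g', h', hp, hg⟩ := h.rotate hx
  have hy' : y ∈ c' := by simpa [hxy.symm] using hp.mem_iff.mpr hy
  obtain ⟨m, n, rfl⟩ := List.append_of_mem hy'
  obtain ⟨g₁, g₂, h₁, h₂, rfl⟩ := split (l₁ := x :: m) (l₂ := n ++ [x]) (by simpa using h')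
  exact ⟨m, n, g₁, g₂, h₁, h₂, by simpa using hp, hg⟩

end Traces

/-- All `s`–`t` paths have the same label. -/
def UniqueLabel (G : LGraph V Γ) (s t : V) : Prop :=
  ∀ ⦃S S' : List V⦄ ⦃g g' : Γ⦄, G.Traces s S t g → G.Traces s S' t g' → S.Nodup → S'.Nodup → g = g'

/-- If `s` and `t` are linked to distinct vertices of a cycle by disjoint paths meeting the cycle
only at their ends, then the cycle is balanced. -/
theorem UniqueLabel.label_eq_one_of_linked {s t v x y : V} {c a b : List V} {g gA gB : Γ}
    (hU : G.UniqueLabel s t) (hC : G.Traces v (c ++ [v]) v g) (hc : c.Nodup)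
    (hx : x ∈ c) (hy : y ∈ c) (hxy : x ≠ y)
    (hA : G.Traces s (a ++ [x]) x gA) (hB : G.Traces y (y :: b) t gB)
    (hn : (a ++ b).Nodup) (hac : ∀ u ∈ a, u ∉ c) (hbc : ∀ u ∈ b, u ∉ c) : g = 1 := by
  obtain ⟨m, n, g₁, g₂, h₁, h₂, hp, hg⟩ := hC.exists_arcs hx hy hxy
  apply hg
  have hr : G.Traces x (x :: n.reverse ++ [y]) y g₂⁻¹ := by simpa using h₂.reverse
  have key : ∀ {k : List V} {γ : Γ}, G.Traces x (x :: k ++ [y]) y γ →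
      G.Traces s (a ++ x :: (k ++ y :: b)) t (gB * (γ * gA)) := fun {k γ} h => by
    simpa using Traces.append (l₁ := a ++ x :: k)
      (by simpa using hA.append (l₂ := k ++ [y]) h) hB
  have hnd : (x :: m ++ y :: n).Nodup := hp.nodup_iff.mpr hc
  have hmem : ∀ u, u ∈ c ↔ u = x ∨ u ∈ m ∨ u = y ∨ u ∈ n := fun u => by
    rw [← hp.mem_iff]; simp
  have nd : ∀ k : List V, (x :: k ++ [y]).Nodup → (∀ u ∈ k, u ∈ c) →
      (a ++ x :: (k ++ y :: b)).Nodup := fun k hk hkc => by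
    simp only [List.nodup_append, List.nodup_cons, List.cons_append, List.mem_append,
      List.mem_cons] at hk hn ⊢
    grind
  have hm : (x :: m ++ [y]).Nodup := by
    clear nd key
    grind
  have hn' : (x :: n.reverse ++ [y]).Nodup := by
    have : (y :: n ++ [x]).Nodup := by
      clear nd key
      grind
    simpa using List.nodup_reverse.mpr this
  have e := hU (key h₁) (key hr) (nd m hm fun u hu => by simp [hmem, hu])
    (nd n.reverse hn' fun u hu => by simp [hmem, List.mem_reverse.mp hu])
  have : g₁ = g₂⁻¹ := by simpa using e
  simp [this]

theorem UniqueLabel.label_eq_one {s t v : V} {c : List V} {g : Γ} (hU : G.UniqueLabel s t)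
    (hP : ∀ u ∈ G.verts, ∃ S γ, G.Traces s S t γ ∧ S.Nodup ∧ u ∈ S)
    (hC : G.Traces v (c ++ [v]) v g) (hc : c.Nodup) (hlen : 2 ≤ c.length) : g = 1 := by
  have two : ∀ {a r b : List V} {x y : V} {γ : Γ},
      G.Traces s (a ++ x :: (r ++ y :: b)) t γ → (a ++ x :: (r ++ y :: b)).Nodup →
      x ∈ c → y ∈ c → (∀ u ∈ a, u ∉ c) → (∀ u ∈ b, u ∉ c) → g = 1 := by
    intro a r b x y γ hW hn hx hy ha hb
    obtain ⟨_, _, hA, -, -⟩ := hW.split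
    obtain ⟨_, _, -, hB, -⟩ := Traces.split (l₁ := a ++ x :: r) (x := y) (l₂ := b)
      (by simpa using hW)
    exact hU.label_eq_one_of_linked hC hc hx hy (by grind) hA hB (by grind) ha hb
  obtain ⟨p, q, hp, hq, hpq⟩ : ∃ p q, p ∈ c ∧ q ∈ c ∧ p ≠ q := by
    match c, hlen with
    | p :: q :: c, _ => exact ⟨p, q, by simp, by simp, by grind⟩
  have hv : ∀ u ∈ c, u ∈ G.verts := fun u hu => hC.mem_verts (by simp; omega) (by simp [hu])
  obtain ⟨P, γ, hPt, hPn, hpP⟩ := hP p (hv p hp)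
  obtain ⟨Q, δ, hQt, hQn, hqQ⟩ := hP q (hv q hq)
  rcases exists_two_or_unique (p := (· ∈ c)) hpP hp with
    ⟨a, x, r, y, b, rfl, hx, hy, ha, hb⟩ | ⟨a, b, rfl, ha, hb⟩
  · exact two hPt hPn hx hy ha hb
  rcases exists_two_or_unique (p := (· ∈ c)) hqQ hq with
    ⟨a, x, r, y, b, rfl, hx, hy, ha, hb⟩ | ⟨a', b', rfl, ha', hb'⟩
  · exact two hQt hQn hx hy ha hb
  obtain ⟨lP, hlP⟩ := hPt.exists_eq_cons
  obtain ⟨lQ, hlQ⟩ := hQt.exists_eq_cons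
  have hsP : s ∈ a ++ p :: b := by simp [hlP]
  have hsQ : s ∈ a' := by
    cases a' with
    | nil => grind
    | cons => grind
  obtain ⟨r, z, r', rfl, hz, hr'⟩ := exists_last_of_mem (p := (· ∈ a ++ p :: b)) hsQ hsP
  obtain ⟨_, _, hQA, -, -⟩ := hQt.split
  obtain ⟨_, _, -, hzq, -⟩ := Traces.split (l₁ := r) (x := z) (l₂ := r' ++ [q])
    (by simpa using hQA)
  obtain ⟨_, _, hPA, hPB, -⟩ := hPt.split
  have hzp : z ≠ p := by grind
  have hz' : z ∈ a ∨ z ∈ b := by simpa [hzp] using hz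
  rcases hz' with hza | hzb
  · obtain ⟨a₁, a₂, rfl⟩ := List.append_of_mem hza
    obtain ⟨_, _, hsz, -, -⟩ := Traces.split (l₁ := a₁) (x := z) (l₂ := a₂ ++ [p])
      (by simpa using hPA)
    have hA := hsz.append hzq
    refine hU.label_eq_one_of_linked (a := a₁ ++ z :: r') hC hc hq hp hpq.symm
      (by simpa using hA) hPB ?_ (by grind) hb
    simp only [List.nodup_append, List.nodup_cons, List.mem_append, List.mem_cons,
      List.append_assoc, List.cons_append] at *
    grind
  · obtain ⟨b₁, b₂, rfl⟩ := List.append_of_mem hzb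
    obtain ⟨_, _, -, hzt, -⟩ := Traces.split (l₁ := p :: b₁) (x := z) (l₂ := b₂)
      (by simpa using hPB)
    have hB := Traces.append (l₁ := q :: r'.reverse) (by simpa using hzq.reverse) hzt
    refine hU.label_eq_one_of_linked (b := r'.reverse ++ z :: b₂) hC hc hp hq hpq
      hPA (by simpa using hB) ?_ ha (by grind)
    simp only [List.nodup_append, List.nodup_cons, List.mem_append, List.mem_cons,
      List.append_assoc, List.cons_append, List.nodup_reverse, List.mem_reverse] at *
    grind

namespace Walk

theorem mem_support_of_mem_arcsList {u w x y : V} {a : V × V × Γ} {W : G.Walk u w}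
    (h : a ∈ W.arcsList) (hc : connects a x y) : x ∈ W.support := by
  induction W with
  | nil v => simp [arcsList] at h
  | cons u v b hb hs W ih =>
    simp only [arcsList, List.mem_cons] at h
    rcases h with rfl | h
    · obtain ⟨l, hl⟩ := Traces.exists_eq_cons ⟨W, rfl, rfl⟩
      simp only [support, hl, List.mem_cons]
      unfold connects at hc hs
      grind
    · exact List.mem_cons_of_mem _ (ih h)

theorem IsPath.arcsList_nodup {u w : V} {W : G.Walk u w} (h : W.IsPath) : W.arcsList.Nodup := by
  induction W with
  | nil v => simp [arcsList]
  | cons u v b hb hs W ih =>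
    have h' := List.nodup_cons.mp h
    exact List.nodup_cons.mpr ⟨fun hm => h'.1 (mem_support_of_mem_arcsList hm hs), ih h'.2⟩

theorem label_eq_one_of_nodup (hG : G.Balanced) {v : V} (W : G.Walk v v)
    (h : W.support.dropLast.Nodup) : W.label = 1 := by
  cases W with
  | nil => rfl
  | cons _ x a ha hs W =>
    have hP : W.support.Nodup := by
      obtain ⟨l, hl⟩ := Traces.exists_eq_concat ⟨W, rfl, rfl⟩
      have : (v :: l).Nodup := by
        have e : v :: (l ++ [v]) = v :: l ++ [v] := rfl
        rwa [support, hl, e, List.dropLast_concat] at h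
      rw [hl]
      grind
    by_cases hm : a ∈ W.arcsList
    · have hne := G.loopless a ha
      cases W with
      | nil => simp [arcsList] at hm
      | cons _ y b hb hs' W =>
        have hP' := List.nodup_cons.mp hP
        rcases List.mem_cons.mp hm with rfl | hm
        · obtain rfl : y = v := by
            unfold connects at hs hs'
            grind
          cases W with
          | nil => simp [label, stepLabel_reverse ha hs]
          | cons _ z b hb' hs'' W =>
            obtain ⟨l, hl⟩ := Traces.exists_eq_concat ⟨W, rfl, rfl⟩
            simp [support, hl] at hP'
        · exact absurd (mem_support_of_mem_arcsList hm hs.symm) hP'.1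
    · exact hG v _ ⟨by simp [length], List.nodup_cons.mpr ⟨hm, IsPath.arcsList_nodup hP⟩, h⟩

end Walk

theorem Balanced.label_eq_one (hG : G.Balanced) {v : V} {S : List V} {g : Γ}
    (h : G.Traces v S v g) : g = 1 := by
  induction hn : S.length using Nat.strong_induction_on generalizing v S g with
  | _ n ih =>
    subst hn
    by_cases hd : S.dropLast.Nodup
    · obtain ⟨W, rfl, rfl⟩ := h
      exact W.label_eq_one_of_nodup hG hd
    · obtain ⟨c, rfl⟩ := h.exists_eq_concat
      rw [List.dropLast_concat] at hd
      obtain ⟨l₁, x, l₂, l₃, rfl⟩ := exists_repeat_of_not_nodup hd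
      obtain ⟨g₁, g', h₁, h', rfl⟩ := Traces.split (l₁ := l₁) (x := x)
        (l₂ := l₂ ++ x :: (l₃ ++ [v])) (by simpa using h)
      obtain ⟨g₂, g₃, h₂, h₃, rfl⟩ := Traces.split (l₁ := x :: l₂) h'
      have e₂ : g₂ = 1 := ih _ (by simp; omega) h₂ rfl
      have e₁ : g₃ * g₁ = 1 := ih _ (by simp) (h₁.append h₃) rfl
      simp [e₂, e₁]

end LGraph

open LGraph in
/-- For any `(G, s, t) ∈ 𝒟`, the set `l(G; s, t)` consists of exactly
one element iff `G` is balanced. -/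
theorem labelSet_singleton_iff_balanced {V Γ : Type} [Group Γ] [DecidableEq V]
    (G : LGraph V Γ) (s t : V) (hD : G.MemD s t) :
    (∃ γ : Γ, labelSet G s t = {γ}) ↔ G.Balanced := by
  obtain ⟨-, hs, -, hP, -⟩ := hD
  constructor
  · rintro ⟨γ, hγ⟩ v C ⟨hlen, -, hn⟩
    have hU : G.UniqueLabel s t := by
      rintro _ _ _ _ ⟨P, rfl, rfl⟩ ⟨Q, rfl, rfl⟩ hPn hQn
      have h₁ : P.label ∈ labelSet G s t := ⟨P, hPn, rfl⟩
      have h₂ : Q.label ∈ labelSet G s t := ⟨Q, hQn, rfl⟩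
      rw [hγ] at h₁ h₂
      exact h₁.trans h₂.symm
    obtain ⟨c, hc⟩ := Traces.exists_eq_concat ⟨C, rfl, rfl⟩
    rw [hc, List.dropLast_concat] at hn
    refine hU.label_eq_one ?_ ⟨C, hc, rfl⟩ hn ?_
    · intro u hu
      obtain ⟨P, hPn, huP⟩ := hP u hu
      exact ⟨_, _, ⟨P, rfl, rfl⟩, hPn, huP⟩
    · cases C with
      | nil => simp [Walk.length] at hlen
      | cons _ x a ha hstep W =>
        cases W with
        | nil =>
          have := G.loopless a ha
          unfold connects at hstep
          grind
        | cons _ y b hb hstep' W =>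
          obtain ⟨l, hl⟩ := Traces.exists_eq_cons ⟨W, rfl, rfl⟩
          have := congrArg List.length hc
          simp [Walk.support, hl] at this
          omega
  · intro hG
    obtain ⟨P, hPn, -⟩ := hP s hs
    refine ⟨P.label, Set.eq_singleton_iff_unique_mem.mpr ⟨⟨P, hPn, rfl⟩, ?_⟩⟩
    rintro _ ⟨Q, -, rfl⟩
    obtain ⟨l, hl⟩ := Traces.exists_eq_concat ⟨Q, rfl, rfl⟩
    have hrev := Traces.reverse ⟨P, rfl, rfl⟩
    obtain ⟨r, hr⟩ := hrev.exists_eq_cons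
    have := hG.label_eq_one (Traces.append ⟨Q, hl, rfl⟩ (hr ▸ hrev))
    exact (inv_mul_eq_one.mp this).symm
end

section
/- Let Γ be a group and suppose a triplet (𝔾, s, t) ∈ 𝒟 satisfies l(𝔾; s, t) = {α', β'} for some distinct elements α', β' ∈ Γ. Then α'β'⁻¹ ≠ β'α'⁻¹ if and only if 𝔾 contains no unbalanced cycle C with ψ_𝔾(C̄) = ψ_𝔾(C), where C̄ denotes the reversed cycle (equivalently, no unbalanced cycle C with ψ_𝔾(C)² = 1_Γ). -/
namespace LGraph

variable {V Γ : Type} [Group Γ]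

namespace Walk

variable {G : LGraph V Γ}

/-- Concatenation of walks. -/
def append : {u v w : V} → G.Walk u v → G.Walk v w → G.Walk u w
  | _, _, _, .nil _, B => B
  | _, _, _, .cons u x a ha h A, B => .cons u x a ha h (A.append B)

/-- The walk traversed backwards. -/
def reverse : {u v : V} → G.Walk u v → G.Walk v u
  | _, _, .nil v => .nil v
  | _, _, .cons u x a ha h A => A.reverse.append (.cons x u a ha h.symm (.nil u))

theorem length_append {u v w : V} (A : G.Walk u v) (B : G.Walk v w) :
    (A.append B).length = A.length + B.length := by
  induction A with
  | nil => simp [append, length]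
  | cons u x a ha h A ih => simp only [append, length, ih]; omega

theorem append_assoc {u v w x : V} (A : G.Walk u v) (B : G.Walk v w) (D : G.Walk w x) :
    (A.append B).append D = A.append (B.append D) := by
  induction A with
  | nil => rfl
  | cons u x a ha h A ih => simp only [append, ih]

theorem start_mem_support {u v : V} (A : G.Walk u v) : u ∈ A.support := by
  cases A <;> simp [support]

theorem end_mem_support {u v : V} (A : G.Walk u v) : v ∈ A.support := by
  induction A <;> simp_all [support]

theorem mem_support_append {u v w x : V} (A : G.Walk u v) (B : G.Walk v w) :
    x ∈ (A.append B).support ↔ x ∈ A.support ∨ x ∈ B.support := by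
  induction A with
  | nil v =>
    simp only [append, support, List.mem_singleton, iff_or_self]
    rintro rfl
    exact B.start_mem_support
  | cons u y a ha h A ih => simp [append, support, ih, or_assoc]

theorem mem_support_reverse {u v x : V} (A : G.Walk u v) :
    x ∈ A.reverse.support ↔ x ∈ A.support := by
  induction A with
  | nil => rfl
  | cons u y a ha h A ih =>
    simp only [reverse, mem_support_append, ih, support, List.mem_cons, List.not_mem_nil, or_false]
    have := A.start_mem_support
    grind

theorem isPath_nil (v : V) : (nil v : G.Walk v v).IsPath := by simp [IsPath, support]

theorem isPath_cons {u v w : V} {a : V × V × Γ} {ha : a ∈ G.arcs} {h : connects a u v}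
    {A : G.Walk v w} : (cons u v a ha h A).IsPath ↔ u ∉ A.support ∧ A.IsPath := by
  simp [IsPath, support]

theorem isPath_append {u v w : V} (A : G.Walk u v) (B : G.Walk v w) :
    (A.append B).IsPath ↔ A.IsPath ∧ B.IsPath ∧ ∀ x ∈ A.support, x ∈ B.support → x = v := by
  induction A with
  | nil v => simp [append, support, isPath_nil]
  | cons u y a ha h A ih =>
    simp only [append, isPath_cons, mem_support_append, ih B, support, List.mem_cons]
    have := A.end_mem_support
    constructor
    · grind
    · rintro ⟨⟨h1, h2⟩, h3, h4⟩
      refine ⟨?_, h2, h3, fun x hx => h4 x (Or.inr hx)⟩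
      rintro (h5 | h5)
      · exact h1 h5
      · have := h4 u (Or.inl rfl) h5
        grind

theorem IsPath.reverse {u v : V} {A : G.Walk u v} (hA : A.IsPath) : A.reverse.IsPath := by
  induction A with
  | nil => exact hA
  | cons u y a ha h A ih =>
    rw [isPath_cons] at hA
    have huy : y ≠ u := by
      rintro rfl
      exact hA.1 A.start_mem_support
    simp only [Walk.reverse, isPath_append, isPath_cons, isPath_nil, support, List.mem_cons,
      List.not_mem_nil, or_false, mem_support_reverse]
    refine ⟨ih hA.2, ⟨huy, trivial⟩, ?_⟩
    rintro x hx (rfl | rfl)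
    · rfl
    · exact absurd hx hA.1

theorem exists_eq_append {u v x : V} (A : G.Walk u v) (hx : x ∈ A.support) :
    ∃ (B : G.Walk u x) (D : G.Walk x v), A = B.append D := by
  induction A with
  | nil v =>
    obtain rfl : x = v := by simpa [support] using hx
    exact ⟨nil x, nil x, rfl⟩
  | cons u y a ha h A ih =>
    rcases List.mem_cons.mp hx with rfl | hx
    · exact ⟨nil x, _, rfl⟩
    · obtain ⟨B, D, rfl⟩ := ih hx
      exact ⟨cons u y a ha h B, D, rfl⟩

/-- A path starting in `S` has a final segment meeting `S` only in its first vertex. -/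
theorem exists_last_mem (S : Set V) {u w : V} (A : G.Walk u w) (hA : A.IsPath) (hu : u ∈ S) :
    ∃ (p : V) (D : G.Walk p w), p ∈ S ∧ D.IsPath ∧ (∀ x ∈ D.support, x ∈ A.support) ∧
      ∀ x ∈ D.support, x ∈ S → x = p := by
  suffices H : (∃ (p : V) (D : G.Walk p w), p ∈ S ∧ D.IsPath ∧ (∀ x ∈ D.support, x ∈ A.support) ∧
      ∀ x ∈ D.support, x ∈ S → x = p) ∨ ∀ x ∈ A.support, x ∉ S from
    H.resolve_right fun h => h u A.start_mem_support hu
  clear hu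
  induction A with
  | nil v =>
    by_cases hv : v ∈ S
    · exact Or.inl ⟨v, nil v, hv, hA, fun x hx => hx, by simp [support]⟩
    · exact Or.inr (by simpa [support] using hv)
  | cons u y a ha h A ih =>
    rcases ih (isPath_cons.mp hA).2 with ⟨p, D, h1, h2, h3, h4⟩ | hn
    · exact Or.inl ⟨p, D, h1, h2, fun x hx => List.mem_cons_of_mem _ (h3 x hx), h4⟩
    · by_cases hu : u ∈ S
      · refine Or.inl ⟨u, cons u y a ha h A, hu, hA, fun x hx => hx, fun x hx hxS => ?_⟩
        rcases List.mem_cons.mp hx with rfl | hx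
        · rfl
        · exact absurd hxS (hn x hx)
      · refine Or.inr fun x hx => ?_
        rcases List.mem_cons.mp hx with rfl | hx
        · exact hu
        · exact hn x hx

theorem isPath_or_exists_closed {u w : V} (A : G.Walk u w) :
    A.IsPath ∨ ∃ (x : V) (B : G.Walk u x) (L : G.Walk x x) (D : G.Walk x w),
      1 ≤ L.length ∧ A = B.append (L.append D) := by
  induction A with
  | nil v => exact Or.inl (isPath_nil v)
  | cons u y a ha h A ih =>
    rcases ih with hp | ⟨x, B, L, D, hL, rfl⟩
    · by_cases hu : u ∈ A.support
      · obtain ⟨B, D, rfl⟩ := A.exists_eq_append hu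
        exact Or.inr ⟨u, nil u, cons u y a ha h B, D, by simp [length], rfl⟩
      · exact Or.inl (isPath_cons.mpr ⟨hu, hp⟩)
    · exact Or.inr ⟨x, cons u y a ha h B, L, D, hL, rfl⟩

theorem endpoints_mem_support {u w : V} (A : G.Walk u w) {a : V × V × Γ} (ha : a ∈ A.arcsList) :
    a.1 ∈ A.support ∧ a.2.1 ∈ A.support := by
  induction A with
  | nil => simp [arcsList] at ha
  | cons u y b hb h A ih =>
    rcases List.mem_cons.mp ha with rfl | ha
    · have := A.start_mem_support
      rcases h with ⟨h1, h2⟩ | ⟨h1, h2⟩ <;> simp [support, h1, h2, this]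
    · exact ⟨List.mem_cons_of_mem _ (ih ha).1, List.mem_cons_of_mem _ (ih ha).2⟩

theorem mem_support_of_connects {u w x y : V} (A : G.Walk u w) {a : V × V × Γ}
    (ha : a ∈ A.arcsList) (h : connects a x y) : x ∈ A.support ∧ y ∈ A.support := by
  have := A.endpoints_mem_support ha
  rcases h with ⟨rfl, rfl⟩ | ⟨rfl, rfl⟩
  · exact this
  · exact this.symm

theorem IsPath.arcsList_nodup_s6 {u w : V} {A : G.Walk u w} (hA : A.IsPath) : A.arcsList.Nodup := by
  induction A with
  | nil => simp [arcsList]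
  | cons u y a ha h A ih =>
    rw [isPath_cons] at hA
    exact List.nodup_cons.mpr ⟨fun hm => hA.1 (A.mem_support_of_connects hm h).1, ih hA.2⟩

theorem IsPath.eq_nil {u : V} {A : G.Walk u u} (hA : A.IsPath) : A = nil u := by
  cases A with
  | nil => rfl
  | cons _ y a ha h A => exact absurd A.end_mem_support (isPath_cons.mp hA).1

theorem support_eq_dropLast {u w : V} (A : G.Walk u w) :
    A.support = A.support.dropLast ++ [w] := by
  induction A with
  | nil => rfl
  | cons u y a ha h A ih =>
    have hne : A.support ≠ [] := List.ne_nil_of_mem A.start_mem_support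
    simp only [support, List.dropLast_cons_of_ne_nil hne, List.cons_append, ← ih]

theorem nodup_dropLast_cons {u y : V} {a : V × V × Γ} {ha : a ∈ G.arcs} {h : connects a u y}
    {A : G.Walk y u} : (cons u y a ha h A).support.dropLast.Nodup ↔ A.IsPath := by
  have hne : A.support ≠ [] := List.ne_nil_of_mem A.start_mem_support
  rw [IsPath, A.support_eq_dropLast]
  simp only [support, List.dropLast_cons_of_ne_nil hne]
  rw [List.nodup_append_comm]
  simp

end Walk

theorem ne_of_connects (G : LGraph V Γ) {a : V × V × Γ} (ha : a ∈ G.arcs) {u v : V}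
    (h : connects a u v) : u ≠ v := by
  rcases h with ⟨rfl, rfl⟩ | ⟨rfl, rfl⟩
  · exact G.loopless a ha
  · exact (G.loopless a ha).symm

theorem mem_verts_of_connects (G : LGraph V Γ) {a : V × V × Γ} (ha : a ∈ G.arcs) {u v : V}
    (h : connects a u v) : u ∈ G.verts := by
  rcases h with ⟨rfl, rfl⟩ | ⟨rfl, rfl⟩
  · exact G.tail_mem a ha
  · exact G.head_mem a ha

/-- `S` is linked to `s` and `t` by two disjoint paths, each meeting `S` only in its
first vertex. -/
def Linked (G : LGraph V Γ) (S : Set V) (s t : V) : Prop :=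
  ∃ (p q : V) (A : G.Walk p s) (B : G.Walk q t), p ∈ S ∧ q ∈ S ∧ A.IsPath ∧ B.IsPath ∧
    (∀ x ∈ A.support, x ∈ S → x = p) ∧ (∀ x ∈ B.support, x ∈ S → x = q) ∧
    ∀ x ∈ A.support, x ∉ B.support

theorem Linked.symm {G : LGraph V Γ} {S : Set V} {s t : V} (h : G.Linked S s t) :
    G.Linked S t s := by
  obtain ⟨p, q, A, B, hp, hq, hA, hB, hAS, hBS, hAB⟩ := h
  exact ⟨q, p, B, A, hq, hp, hB, hA, hBS, hAS, fun x hx hx' => hAB x hx' hx⟩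

/-- A fork at `p ∈ S` leading to `s` and `t` is turned into a linkage by a path from `S`
that reaches the branch leading to `s` outside `p`. -/
theorem linked_of_fork {G : LGraph V Γ} {S : Set V} {s t p y z : V}
    {A : G.Walk p s} {B : G.Walk p t} {T : G.Walk y z} (hp : p ∈ S) (hy : y ∈ S)
    (hA : A.IsPath) (hB : B.IsPath) (hT : T.IsPath)
    (hAS : ∀ x ∈ A.support, x ∈ S → x = p) (hBS : ∀ x ∈ B.support, x ∈ S → x = p)
    (hTS : ∀ x ∈ T.support, x ∈ S → x = y) (hAB : ∀ x ∈ A.support, x ∈ B.support → x = p)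
    (hTA : ∀ x ∈ T.support, x ∈ A.support → x = z)
    (hTB : ∀ x ∈ T.support, x ∈ B.support → x = z)
    (hz : z ∈ A.support) (hzp : z ≠ p) : G.Linked S s t := by
  obtain ⟨A₁, A₂, rfl⟩ := A.exists_eq_append hz
  rw [Walk.isPath_append] at hA
  simp only [Walk.mem_support_append] at hAS hAB hTA
  have hpA : p ∉ A₂.support := fun h => hzp (hA.2.2 p A₁.start_mem_support h).symm
  have hzA := A₂.start_mem_support
  refine ⟨y, p, T.append A₂, B, hy, hp, ?_, hB, ?_, hBS, ?_⟩
  · rw [Walk.isPath_append]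
    exact ⟨hT, hA.2.1, fun x hx hx' => hTA x hx (Or.inr hx')⟩
  · intro x hx hxS
    rcases (Walk.mem_support_append _ _).mp hx with hx | hx
    · exact hTS x hx hxS
    · exact absurd (hAS x (Or.inr hx) hxS ▸ hx) hpA
  · intro x hx hxB
    rcases (Walk.mem_support_append _ _).mp hx with hx | hx
    · exact hzp (hAB z (Or.inr hzA) (hTB x hx hxB ▸ hxB))
    · exact hpA (hAB x (Or.inr hx) hxB ▸ hx)

/-- If every vertex lies on an `s`–`t` path, then any set of at least two vertices is linked
to `s` and `t`. -/
theorem linked_of_forall_mem_path {G : LGraph V Γ} {s t : V}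
    (hG : ∀ v ∈ G.verts, ∃ P : G.Walk s t, P.IsPath ∧ v ∈ P.support) {S : Set V} {u v : V}
    (huG : u ∈ G.verts) (hvG : v ∈ G.verts) (hu : u ∈ S) (hv : v ∈ S) (huv : u ≠ v) :
    G.Linked S s t := by
  obtain ⟨R, hR, huR⟩ := hG u huG
  obtain ⟨X, Y, rfl⟩ := R.exists_eq_append huR
  obtain ⟨hX, hY, hXY⟩ := (Walk.isPath_append _ _).mp hR
  obtain ⟨p, A, hp, hA, hAX, hAS⟩ := X.reverse.exists_last_mem S hX.reverse hu
  obtain ⟨q, B, hq, hB, hBY, hBS⟩ := Y.exists_last_mem S hY hu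
  simp only [Walk.mem_support_reverse] at hAX
  have hABu : ∀ x ∈ A.support, x ∈ B.support → x = u :=
    fun x hx hx' => hXY x (hAX x hx) (hBY x hx')
  by_cases hpq : p = q
  · subst hpq
    obtain rfl : p = u := hABu p A.start_mem_support B.start_mem_support
    obtain ⟨R', hR', hvR'⟩ := hG v hvG
    obtain ⟨r, T, hrT, hT, hpT⟩ : ∃ (r : V) (T : G.Walk v r),
        (r ∈ A.support ∨ r ∈ B.support) ∧ T.IsPath ∧ p ∉ T.support := by
      obtain ⟨X', Y', rfl⟩ := R'.exists_eq_append hvR'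
      obtain ⟨hX', hY', hXY'⟩ := (Walk.isPath_append _ _).mp hR'
      by_cases hpX : p ∈ X'.support
      · exact ⟨t, Y', Or.inr B.end_mem_support, hY', fun h => huv (hXY' p hpX h)⟩
      · exact ⟨s, X'.reverse, Or.inl A.end_mem_support, hX'.reverse,
          fun h => hpX (X'.mem_support_reverse.mp h)⟩
    obtain ⟨z, T₁, hz, hT₁, hT₁T, hT₁R⟩ :=
      T.reverse.exists_last_mem {x | x ∈ A.support ∨ x ∈ B.support} hT.reverse hrT
    obtain ⟨y, T₂, hy, hT₂, hT₂T, hT₂S⟩ := T₁.reverse.exists_last_mem S hT₁.reverse hv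
    simp only [Walk.mem_support_reverse] at hT₁T hT₂T
    have hzp : z ≠ p := by
      rintro rfl
      exact hpT (hT₁T _ T₁.start_mem_support)
    have hTA : ∀ x ∈ T₂.support, x ∈ A.support → x = z :=
      fun x hx hxA => hT₁R x (hT₂T x hx) (Or.inl hxA)
    have hTB : ∀ x ∈ T₂.support, x ∈ B.support → x = z :=
      fun x hx hxB => hT₁R x (hT₂T x hx) (Or.inr hxB)
    rcases hz with hz | hz
    · exact linked_of_fork hp hy hA hB hT₂ hAS hBS hT₂S hABu hTA hTB hz hzp
    · exact (linked_of_fork hp hy hB hA hT₂ hBS hAS hT₂S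
        (fun x hx hx' => hABu x hx' hx) hTB hTA hz hzp).symm
  · refine ⟨p, q, A, B, hp, hq, hA, hB, hAS, hBS, fun x hx hx' => hpq ?_⟩
    obtain rfl := hABu x hx hx'
    rw [← hAS x hx hu, ← hBS x hx' hu]

variable [DecidableEq V]

theorem stepLabel_swap (G : LGraph V Γ) {a : V × V × Γ} (ha : a ∈ G.arcs) {u v : V}
    (h : connects a u v) : stepLabel u a = (stepLabel v a)⁻¹ := by
  have := G.loopless a ha
  rcases h with ⟨rfl, rfl⟩ | ⟨rfl, rfl⟩
  · simp [stepLabel, this.symm]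
  · simp [stepLabel, this.symm]

namespace Walk

variable {G : LGraph V Γ}

theorem label_append {u v w : V} (A : G.Walk u v) (B : G.Walk v w) :
    (A.append B).label = B.label * A.label := by
  induction A with
  | nil => simp [append, label]
  | cons u x a ha h A ih => simp only [append, label, ih, mul_assoc]

theorem label_reverse {u v : V} (A : G.Walk u v) : A.reverse.label = A.label⁻¹ := by
  induction A with
  | nil => simp [reverse, label]
  | cons u x a ha h A ih =>
    simp [reverse, label, label_append, ih, stepLabel_swap G ha h]

/-- Closing up a path by an arc gives a cycle, unless the path is that same arc. -/
theorem isCycle_cons {u y : V} {a : V × V × Γ} {ha : a ∈ G.arcs} {h : connects a u y}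
    {A : G.Walk y u} (hA : A.IsPath) (hl : (cons u y a ha h A).label ≠ 1) :
    (cons u y a ha h A).IsCycle := by
  refine ⟨by simp [length], ?_, nodup_dropLast_cons.mpr hA⟩
  refine List.nodup_cons.mpr ⟨fun hm => hl ?_, hA.arcsList_nodup_s6⟩
  cases A with
  | nil => exact absurd rfl (ne_of_connects G ha h)
  | cons _ x b hb hbx A =>
    rw [isPath_cons] at hA
    rcases List.mem_cons.mp hm with rfl | hm
    · obtain rfl : x = u := by
        have := ne_of_connects G ha h
        rcases h with ⟨h1, h2⟩ | ⟨h1, h2⟩ <;> rcases hbx with ⟨h3, h4⟩ | ⟨h3, h4⟩ <;> grind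
      rw [hA.2.eq_nil]
      simp [label, stepLabel_swap G ha h]
    · exact absurd (A.mem_support_of_connects hm h).2 hA.1

theorem exists_unbalanced_cycle {v : V} (W : G.Walk v v) (hW : W.label ≠ 1) :
    ∃ (u : V) (C : G.Walk u u), C.IsCycle ∧ C.label ≠ 1 := by
  induction hn : W.length using Nat.strong_induction_on generalizing v with
  | _ n ih =>
    cases W with
    | nil => exact absurd rfl hW
    | cons _ y a ha h A =>
      rcases A.isPath_or_exists_closed with hA | ⟨x, B, L, D, hL, rfl⟩
      · exact ⟨v, _, isCycle_cons hA hW, hW⟩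
      · simp only [length, length_append] at hn
        by_cases hL1 : L.label = 1
        · refine ih _ ?_ (cons v y a ha h (B.append D)) ?_ rfl
          · simp only [length, length_append]
            omega
          · simpa [label, label_append, hL1] using hW
        · exact ih _ (by omega) L hL1 rfl

theorem exists_two_paths_of_append {u y p q : V} {a : V × V × Γ} {ha : a ∈ G.arcs}
    {h : connects a u y} {X : G.Walk y p} {Y : G.Walk p q} {Z : G.Walk q u}
    (hA : (X.append (Y.append Z)).IsPath)
    (hl : (cons u y a ha h (X.append (Y.append Z))).label ≠ 1) (hpq : p ≠ q) :
    ∃ D E : G.Walk p q, D.IsPath ∧ E.IsPath ∧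
      (∀ x ∈ D.support, x ∈ (X.append (Y.append Z)).support) ∧
      (∀ x ∈ E.support, x ∈ (X.append (Y.append Z)).support) ∧ D.label ≠ E.label ∧
      (D.label * E.label⁻¹ = E.label * D.label⁻¹ ↔
        (cons u y a ha h (X.append (Y.append Z))).label⁻¹ =
          (cons u y a ha h (X.append (Y.append Z))).label) := by
  simp only [isPath_append, mem_support_append] at hA
  obtain ⟨hX, ⟨hY, hZ, hYZ⟩, hXYZ⟩ := hA
  have hXZ : ∀ x ∈ X.support, x ∉ Z.support := by
    intro x hx hx'
    obtain rfl := hXYZ x hx (Or.inr hx')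
    exact hpq (hYZ x Y.start_mem_support hx')
  have hlabel : (cons u y a ha h (X.append (Y.append Z))).label =
      Z.label * Y.label * X.label * stepLabel y a := by
    simp [label, label_append]
  refine ⟨Y, X.reverse.append (cons y u a ha h.symm Z.reverse), hY, ?_, ?_, ?_, ?_, ?_⟩
  · simp only [isPath_append, isPath_cons, mem_support_reverse, support, List.mem_cons]
    refine ⟨hX.reverse, ⟨hXZ y X.start_mem_support, hZ.reverse⟩, ?_⟩
    rintro x hx (hx' | hx')
    · exact hx'
    · exact absurd hx' (hXZ x hx)
  · intro x hx
    simp [mem_support_append, hx]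
  · intro x hx
    simp only [mem_support_append, mem_support_reverse, support, List.mem_cons] at hx ⊢
    have := X.start_mem_support
    grind
  · rw [hlabel] at hl
    simp only [label_append, label, label_reverse, stepLabel_swap G ha h]
    intro H
    apply hl
    rw [H]
    group
  · rw [hlabel]
    simp only [label_append, label, label_reverse, stepLabel_swap G ha h]
    constructor
    · intro H
      have := congrArg (fun g => Z.label * g * Z.label⁻¹) H
      simp only [mul_inv_rev, inv_inv, mul_assoc, mul_inv_cancel_left, mul_inv_cancel,
        mul_one] at this ⊢
      exact this.symm
    · intro H
      have := congrArg (fun g => Z.label⁻¹ * g * Z.label) H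
      simp only [mul_inv_rev, inv_inv, mul_assoc, inv_mul_cancel_left, inv_mul_cancel,
        mul_one] at this ⊢
      exact this.symm

/-- Two distinct vertices of a cycle are joined by two paths along it, whose labels `g ≠ h`
satisfy `g * h⁻¹ = h * g⁻¹` precisely when the label of the cycle is its own inverse. -/
theorem exists_two_paths {u y p q : V} {a : V × V × Γ} {ha : a ∈ G.arcs} {h : connects a u y}
    {A : G.Walk y u} (hA : A.IsPath) (hl : (cons u y a ha h A).label ≠ 1)
    (hp : p ∈ A.support) (hq : q ∈ A.support) (hpq : p ≠ q) :
    ∃ D E : G.Walk p q, D.IsPath ∧ E.IsPath ∧ (∀ x ∈ D.support, x ∈ A.support) ∧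
      (∀ x ∈ E.support, x ∈ A.support) ∧ D.label ≠ E.label ∧
      (D.label * E.label⁻¹ = E.label * D.label⁻¹ ↔
        (cons u y a ha h A).label⁻¹ = (cons u y a ha h A).label) := by
  obtain ⟨X, M, rfl⟩ := A.exists_eq_append hp
  rcases (mem_support_append _ _).mp hq with hq | hq
  · obtain ⟨X, Y, rfl⟩ := X.exists_eq_append hq
    rw [append_assoc] at hA hl ⊢
    obtain ⟨D, E, hD, hE, hDA, hEA, hne, hiff⟩ := exists_two_paths_of_append hA hl hpq.symm
    refine ⟨D.reverse, E.reverse, hD.reverse, hE.reverse,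
      fun x hx => hDA x (D.mem_support_reverse.mp hx),
      fun x hx => hEA x (E.mem_support_reverse.mp hx), ?_, ?_⟩
    · simpa [label_reverse] using hne
    · rw [← hiff]
      simp only [label_reverse, inv_inv]
      constructor
      · intro H
        have := congrArg (fun g => E.label * g * E.label⁻¹) H
        simpa [mul_assoc, eq_comm] using this
      · intro H
        have := congrArg (fun g => E.label⁻¹ * g * E.label) H
        simpa [mul_assoc, eq_comm] using this
  · obtain ⟨Y, Z, rfl⟩ := M.exists_eq_append hq
    exact exists_two_paths_of_append hA hl hpq

end Walk

/-- An unbalanced cycle in a graph all of whose vertices lie on `s`–`t` paths yields two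
`s`–`t` paths with distinct labels `g` and `h` that satisfy `g * h⁻¹ = h * g⁻¹` precisely
when the label of the cycle is its own inverse. -/
theorem exists_two_paths_of_cycle {G : LGraph V Γ} {s t : V}
    (hG : ∀ v ∈ G.verts, ∃ P : G.Walk s t, P.IsPath ∧ v ∈ P.support) {v : V} {C : G.Walk v v}
    (hC : C.IsCycle) (hl : C.label ≠ 1) :
    ∃ P Q : G.Walk s t, P.IsPath ∧ Q.IsPath ∧ P.label ≠ Q.label ∧
      (P.label * Q.label⁻¹ = Q.label * P.label⁻¹ ↔ C.label⁻¹ = C.label) := by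
  cases C with
  | nil => exact absurd rfl hl
  | cons _ y a ha h W =>
    have hW : W.IsPath := Walk.nodup_dropLast_cons.mp hC.2.2
    obtain ⟨p, q, A, B, hp, hq, hA, hB, hAS, hBS, hAB⟩ :=
      linked_of_forall_mem_path hG (S := {x | x ∈ W.support}) (mem_verts_of_connects G ha h)
        (mem_verts_of_connects G ha h.symm) W.end_mem_support W.start_mem_support
        (ne_of_connects G ha h)
    have hpq : p ≠ q := by
      rintro rfl
      exact hAB p A.start_mem_support B.start_mem_support
    obtain ⟨D, E, hD, hE, hDW, hEW, hne, hiff⟩ := Walk.exists_two_paths hW hl hp hq hpq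
    have hpath : ∀ F : G.Walk p q, F.IsPath → (∀ x ∈ F.support, x ∈ W.support) →
        (A.reverse.append (F.append B)).IsPath := by
      intro F hF hFW
      simp only [Walk.isPath_append, Walk.mem_support_append, Walk.mem_support_reverse]
      refine ⟨hA.reverse, ⟨hF, hB, fun x hx hx' => hBS x hx' (hFW x hx)⟩, ?_⟩
      rintro x hx (hx' | hx')
      · exact hAS x hx (hFW x hx')
      · exact absurd hx' (hAB x hx)
    refine ⟨_, _, hpath D hD hDW, hpath E hE hEW, ?_, ?_⟩
    · simpa [Walk.label_append] using hne
    · rw [← hiff]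
      simp only [Walk.label_append, Walk.label_reverse, mul_inv_rev, inv_inv]
      constructor
      · intro H
        have := congrArg (fun g => B.label⁻¹ * g * B.label) H
        simpa [mul_assoc] using this
      · intro H
        have := congrArg (fun g => B.label * g * B.label⁻¹) H
        simpa [mul_assoc] using this

end LGraph

open LGraph in
/-- Suppose `(G, s, t) ∈ 𝒟` and `l(G; s, t) = {α', β'}` with
`α' ≠ β'`.  Then `α'β'⁻¹ ≠ β'α'⁻¹` iff `G` contains no unbalanced cycle `C` with
`ψ(C̄) = ψ(C)` (i.e. `ψ(C)⁻¹ = ψ(C)`). -/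
theorem noncomm_iff_no_selfinverse_unbalanced_cycle {V Γ : Type} [Group Γ]
    [DecidableEq V] (G : LGraph V Γ) (s t : V) (α' β' : Γ)
    (hne : α' ≠ β') (hD : G.MemD s t)
    (hl : labelSet G s t = {α', β'}) :
    α' * β'⁻¹ ≠ β' * α'⁻¹ ↔
      ¬ ∃ (v : V) (C : G.Walk v v), C.IsCycle ∧ C.label ≠ 1 ∧ C.label⁻¹ = C.label := by
  have key : ∀ (v : V) (C : G.Walk v v), C.IsCycle → C.label ≠ 1 →
      (α' * β'⁻¹ = β' * α'⁻¹ ↔ C.label⁻¹ = C.label) := by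
    intro v C hC hC1
    obtain ⟨P, Q, hP, hQ, hPQ, hiff⟩ := exists_two_paths_of_cycle hD.2.2.2.1 hC hC1
    have hPl : P.label ∈ ({α', β'} : Set Γ) := hl ▸ ⟨P, hP, rfl⟩
    have hQl : Q.label ∈ ({α', β'} : Set Γ) := hl ▸ ⟨Q, hQ, rfl⟩
    rw [← hiff]
    rcases hPl with hPl | hPl <;> rcases hQl with hQl | hQl
    · exact absurd (hPl.trans hQl.symm) hPQ
    · rw [hPl, hQl]
    · rw [hPl, hQl, eq_comm]
    · exact absurd (hPl.trans hQl.symm) hPQ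
  rw [ne_eq, not_iff_not]
  constructor
  · intro H
    obtain ⟨P, -, hPl⟩ : α' ∈ labelSet G s t := by simp [hl]
    obtain ⟨Q, -, hQl⟩ : β' ∈ labelSet G s t := by simp [hl]
    obtain ⟨v, C, hC, hC1⟩ := (P.append Q.reverse).exists_unbalanced_cycle (by
      rw [Walk.label_append, Walk.label_reverse, hPl, hQl, ne_eq, inv_mul_eq_one]
      exact hne.symm)
    exact ⟨v, C, hC, hC1, (key v C hC hC1).mp H⟩
  · rintro ⟨v, C, hC, hC1, H⟩
    exact (key v C hC hC1).mpr H
end
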